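/- There is no barely independent family over ω. That is, there is no infinite family 𝓘 of infinite subsets of ω such that for every nonempty finite 𝓐 ⊆ 𝓘 and every h : 𝓐 → {0,1} the set ⋂_{A ∈ 𝓐} A^{h(A)} is infinite, while for every countably infinite 𝓐 ⊆ 𝓘 and every h : 𝓐 → {0,1} the set ⋂_{A ∈ 𝓐} A^{h(A)} is finite. -/

import Mathlib

open Set

/-- Let `U` be an ultrafilter finer than the cofinite filter and `G ∈ U`. If for every finite
`F ⊆ G` infinitely many `n` are related to `U`-almost every point and to all points of `F`, then
the relation contains a product of two infinite sets. -/
theorem exists_infinite_rectangle {ι α : Type*} (U : Ultrafilter α)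
    (hU : (U : Filter α) ≤ Filter.cofinite) (R : ι → α → Prop) (G : Set α) (hG : G ∈ U)
    (hR : ∀ F : Finset α, ↑F ⊆ G → {n | (∀ᶠ i in U, R n i) ∧ ∀ i ∈ F, R n i}.Infinite) :
    ∃ (X : Set ι) (S : Set α), X.Infinite ∧ S.Infinite ∧ S.Countable ∧
      ∀ n ∈ X, ∀ i ∈ S, R n i := by
  classical
  obtain ⟨f, hf, hr⟩ := exists_seq_of_forall_finset_exists
    (fun p : ι × α => p.2 ∈ G ∧ (∀ᶠ i in U, R p.1 i) ∧ R p.1 p.2)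
    (fun p q => p.1 ≠ q.1 ∧ p.2 ≠ q.2 ∧ R p.1 q.2 ∧ R q.1 p.2) (by
      intro s hs
      have hev : ∀ᶠ i in (U : Filter α), ∀ p ∈ s, R p.1 i :=
        (Filter.eventually_all_finset s).2 fun p hp => (hs p hp).2.1
      have hnew : ∀ᶠ i in (U : Filter α), i ∉ s.image Prod.snd :=
        hU (s.image Prod.snd).finite_toSet.compl_mem_cofinite
      have hGe : ∀ᶠ i in (U : Filter α), i ∈ G := hG
      obtain ⟨i, ⟨hi, his⟩, hiG⟩ := ((hev.and hnew).and hGe).exists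
      obtain ⟨n, ⟨hn, hnF⟩, hns⟩ := (hR (insert i (s.image Prod.snd)) (by
        intro x hx
        simp only [Finset.coe_insert, Finset.coe_image, mem_insert_iff, mem_image] at hx
        rcases hx with rfl | ⟨p, hp, rfl⟩
        · exact hiG
        · exact (hs p hp).1)).exists_notMem_finset (s.image Prod.fst)
      refine ⟨(n, i), ⟨hiG, hn, hnF i (Finset.mem_insert_self _ _)⟩, fun p hp => ⟨?_, ?_, hi p hp,
        hnF _ (Finset.mem_insert_of_mem (Finset.mem_image_of_mem _ hp))⟩⟩
      · rintro rfl
        exact hns (Finset.mem_image_of_mem _ hp)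
      · rintro rfl
        exact his (Finset.mem_image_of_mem _ hp))
  refine ⟨range fun k => (f k).1, range fun k => (f k).2,
    infinite_range_of_injective (.of_lt_imp_ne fun a b h => (hr a b h).1),
    infinite_range_of_injective (.of_lt_imp_ne fun a b h => (hr a b h).2.1),
    countable_range _, ?_⟩
  rintro _ ⟨a, rfl⟩ _ ⟨b, rfl⟩
  rcases lt_trichotomy a b with h | rfl | h
  · exact (hr a b h).2.2.1
  · exact (hf a).2.2
  · exact (hr b a h).2.2.2

/-- There is no barely independent family over `ω`: no infinite family `I` of infinite
subsets of `ℕ` such that every boolean combination (`A^0 = A`, `A^1 = ℕ \ A`) of a nonempty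
finite subfamily is infinite, while every boolean combination of a countably infinite
subfamily is finite. -/
theorem stmt2 :
    ¬ ∃ I : Set (Set ℕ),
      I.Infinite ∧ (∀ A ∈ I, A.Infinite) ∧
      (∀ 𝓐 ⊆ I, 𝓐.Nonempty → 𝓐.Finite → ∀ h : Set ℕ → Fin 2,
        (⋂ A ∈ 𝓐, if h A = 0 then A else Aᶜ).Infinite) ∧
      (∀ 𝓐 ⊆ I, 𝓐.Countable → 𝓐.Infinite → ∀ h : Set ℕ → Fin 2,
        (⋂ A ∈ 𝓐, if h A = 0 then A else Aᶜ).Finite) := by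
  classical
  rintro ⟨I, hI, -, hfin, hcount⟩
  have : Infinite I := hI.to_subtype
  let U : Ultrafilter I := Filter.hyperfilter I
  have hU : (U : Filter I) ≤ Filter.cofinite := Filter.hyperfilter_le_cofinite
  have no_rectangle : ∀ (e : Fin 2) (X : Set ℕ) (S : Set I), X.Infinite → S.Infinite →
      S.Countable → ¬ ∀ n ∈ X, ∀ i ∈ S, n ∈ (if e = 0 then (i : Set ℕ) else (i : Set ℕ)ᶜ) := by
    intro e X S hX hS hSc h
    refine hX ((hcount (Subtype.val '' S) (by rintro _ ⟨i, -, rfl⟩; exact i.2) (hSc.image _)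
      (hS.image Subtype.val_injective.injOn) fun _ => e).subset ?_)
    intro n hn
    simp only [mem_iInter]
    rintro _ ⟨i, hi, rfl⟩
    exact h n hn i hi
  by_cases hc : ∀ F : Finset I, {n : ℕ | (∀ᶠ i : I in U, n ∈ (i : Set ℕ)) ∧
      ∀ i ∈ F, n ∈ (i : Set ℕ)}.Infinite
  · obtain ⟨X, S, hX, hS, hSc, h⟩ := exists_infinite_rectangle U hU
      (fun (n : ℕ) (i : I) => n ∈ (i : Set ℕ)) univ Filter.univ_mem fun F _ => hc F
    exact no_rectangle 0 X S hX hS hSc (by simpa using h)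
  · push Not at hc
    obtain ⟨F, hF⟩ := hc
    obtain ⟨X, S, hX, hS, hSc, h⟩ := exists_infinite_rectangle U hU
      (fun (n : ℕ) (i : I) => n ∉ (i : Set ℕ)) (F : Set I)ᶜ
      (hU F.finite_toSet.compl_mem_cofinite) (by
        intro G hG
        have hinf : {n : ℕ | (∀ i ∈ F, n ∈ (i : Set ℕ)) ∧ ∀ i ∈ G, n ∉ (i : Set ℕ)}.Infinite := by
          obtain ⟨i₀⟩ : Nonempty I := inferInstance
          refine (hfin (Subtype.val '' (↑(insert i₀ (F ∪ G)) : Set I))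
            (by rintro _ ⟨i, -, rfl⟩; exact i.2) (Nonempty.image _ ⟨i₀, by simp⟩)
            ((Finset.finite_toSet _).image _)
            fun A => if A ∈ Subtype.val '' (F : Set I) then 0 else 1).mono ?_
          intro n hn
          simp only [mem_iInter] at hn
          refine ⟨fun i hi => ?_, fun i hi => ?_⟩
          · have := hn i ⟨i, by simp [hi], rfl⟩
            simpa [hi] using this
          · have hiF : i ∉ F := fun h => hG hi h
            have := hn i ⟨i, by simp [hi], rfl⟩
            simpa [hiF] using this
        refine (hinf.sdiff hF).mono ?_
        rintro n ⟨⟨hnF, hnG⟩, hn⟩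
        exact ⟨Ultrafilter.eventually_not.2 fun h => hn ⟨h, hnF⟩, hnG⟩)
    exact no_rectangle 1 X S hX hS hSc (by simpa using h)
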